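/- Let E be a finite-dimensional real inner product space and Φ ⊆ E \ {0} a finite crystallographic root system (possibly non-reduced). If V ⊆ span_ℝ(Φ) is a 2-small subspace and α, β ∈ Φ ∩ V are linearly independent roots, then there exists an irreducible saturated root subsystem Ψ ⊆ Φ of rank 2 with α ∈ Ψ such that β ∉ Ψ and span_ℝ(Ψ) ∩ V = ℝα. -/

import Mathlib

open scoped RealInnerProductSpace

variable {E : Type*} [NormedAddCommGroup E] [InnerProductSpace ℝ E]

/-- The reflection of `x` in the hyperplane orthogonal to `α`. -/
noncomputable def rootReflection (α x : E) : E :=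
  x - (2 * ⟪x, α⟫ / ⟪α, α⟫) • α

/-- `Φ` is a (possibly non-reduced) crystallographic root system in `E`. -/
structure IsRootSystem (Φ : Set E) : Prop where
  finite : Φ.Finite
  ne_zero : ∀ α ∈ Φ, α ≠ 0
  crystallographic : ∀ α ∈ Φ, ∀ β ∈ Φ, ∃ n : ℤ, 2 * ⟪β, α⟫ / ⟪α, α⟫ = (n : ℝ)
  reflect_mem : ∀ α ∈ Φ, ∀ β ∈ Φ, rootReflection α β ∈ Φ

/-- Two roots of `Φ` are related if they both belong to `Φ` and are non-orthogonal. -/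
def chainRel (Φ : Set E) (a b : E) : Prop := a ∈ Φ ∧ b ∈ Φ ∧ ⟪a, b⟫ ≠ 0

/-- The irreducible component of `Φ` containing the root `α`: the set of roots connected to `α`
by a chain of pairwise non-orthogonal roots. -/
def component (Φ : Set E) (α : E) : Set E := {β | Relation.TransGen (chainRel Φ) α β}

/-- A subspace `V ≤ span ℝ Φ` is `k`-small if for every irreducible component `Ψ` of `Φ`
the codimension of `V ∩ span ℝ Ψ` in `span ℝ Ψ` is at least `k`. -/
def IsSmall (Φ : Set E) (V : Submodule ℝ E) (k : ℕ) : Prop :=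
  ∀ α ∈ Φ,
    Module.finrank ℝ ↥(V ⊓ Submodule.span ℝ (component Φ α)) + k ≤
      Module.finrank ℝ ↥(Submodule.span ℝ (component Φ α))

/-- A saturated root subsystem of `Φ`: the intersection of `Φ` with a linear subspace. -/
def IsSaturatedSubsystem (Φ Ψ : Set E) : Prop :=
  ∃ U : Submodule ℝ E, Ψ = Φ ∩ ↑U

/-- A set of roots is irreducible if it is nonempty and any two of its roots are joined by a
chain of pairwise non-orthogonal roots inside it. -/
def IsIrreducibleSubsystem (Ψ : Set E) : Prop :=
  Ψ.Nonempty ∧ ∀ a ∈ Ψ, ∀ b ∈ Ψ, Relation.TransGen (chainRel Ψ) a b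

/-- The rank of a set of roots: the dimension of its real span. -/
noncomputable def rootRank (Ψ : Set E) : ℕ :=
  Module.finrank ℝ ↥(Submodule.span ℝ Ψ)

/-- A root in the component of `α` is non-orthogonal to some root which is itself non-orthogonal
to `α`. -/
theorem exists_common_nonorthogonal {Φ : Set E} (hΦ : IsRootSystem Φ) {α : E} (hα : α ∈ Φ)
    {δ : E} (hδ : δ ∈ component Φ α) :
    ∃ γ ∈ Φ, ⟪γ, α⟫ ≠ 0 ∧ ⟪γ, δ⟫ ≠ 0 := by
  have hαα : ⟪α, α⟫ ≠ 0 := inner_self_ne_zero.2 (hΦ.ne_zero α hα)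
  induction hδ with
  | single h => exact ⟨α, hα, hαα, h.2.2⟩
  | @tail b c _ h ih =>
    obtain ⟨γ, hγ, hγα, hγb⟩ := ih
    obtain ⟨hb, _, hbc⟩ := h
    by_cases h1 : ⟪γ, c⟫ = 0
    · by_cases h2 : ⟪b, α⟫ = 0
      · refine ⟨rootReflection b γ, hΦ.reflect_mem b hb γ hγ, ?_, ?_⟩
        · simpa [rootReflection, inner_sub_left, inner_smul_left, h2] using hγα
        · have hbb : ⟪b, b⟫ ≠ 0 := inner_self_ne_zero.2 (hΦ.ne_zero b hb)
          rw [rootReflection, inner_sub_left, real_inner_smul_left, h1, zero_sub]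
          exact neg_ne_zero.2 (mul_ne_zero (div_ne_zero (mul_ne_zero two_ne_zero hγb) hbb) hbc)
      · exact ⟨b, hb, h2, hbc⟩
    · exact ⟨γ, hγ, hγα, h1⟩

theorem mem_of_mem_component {Φ : Set E} {α δ : E} (hδ : δ ∈ component Φ α) : δ ∈ Φ := by
  cases hδ with
  | single h => exact h.2.1
  | tail _ h => exact h.2.1

/-- A subspace containing all roots non-orthogonal to `α` contains the component of `α`. -/
theorem component_subset_of_nonorthogonal {Φ : Set E} (hΦ : IsRootSystem Φ) {α : E} (hα : α ∈ Φ)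
    (V : Submodule ℝ E) (h : ∀ γ ∈ Φ, ⟪γ, α⟫ ≠ 0 → γ ∈ V) :
    component Φ α ⊆ V := by
  intro δ hδ
  have hδΦ := mem_of_mem_component hδ
  by_cases hδα : ⟪δ, α⟫ = 0
  · obtain ⟨γ, hγ, hγα, hγδ⟩ := exists_common_nonorthogonal hΦ hα hδ
    have hγγ : ⟪γ, γ⟫ ≠ 0 := inner_self_ne_zero.2 (hΦ.ne_zero γ hγ)
    have hmem : rootReflection γ δ ∈ V := by
      refine h _ (hΦ.reflect_mem γ hγ δ hδΦ) ?_
      rw [rootReflection, inner_sub_left, real_inner_smul_left, hδα, zero_sub]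
      rw [real_inner_comm] at hγδ
      exact neg_ne_zero.2 (mul_ne_zero (div_ne_zero (mul_ne_zero two_ne_zero hγδ) hγγ) hγα)
    exact (Submodule.sub_mem_iff_left V (V.smul_mem _ (h γ hγ hγα))).1 hmem
  · exact h δ hδΦ hδα

/-- The roots in the plane spanned by two non-orthogonal roots form an irreducible system. -/
theorem isIrreducibleSubsystem_inter_span_pair {Φ : Set E} (hΦ : IsRootSystem Φ) {α γ : E}
    (hα : α ∈ Φ) (hγ : γ ∈ Φ) (hγα : ⟪γ, α⟫ ≠ 0) :
    IsIrreducibleSubsystem (Φ ∩ (Submodule.span ℝ {α, γ} : Submodule ℝ E)) := by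
  set Ψ : Set E := Φ ∩ (Submodule.span ℝ {α, γ} : Submodule ℝ E)
  have hαΨ : α ∈ Ψ := ⟨hα, Submodule.subset_span (by simp)⟩
  have hγΨ : γ ∈ Ψ := ⟨hγ, Submodule.subset_span (by simp)⟩
  have hsymm : ∀ {a b : E}, chainRel Ψ a b → chainRel Ψ b a :=
    fun h => ⟨h.2.1, h.1, by rw [real_inner_comm]; exact h.2.2⟩
  have key : ∀ a ∈ Ψ, Relation.TransGen (chainRel Ψ) a α := by
    intro a ha
    by_cases h1 : ⟪a, α⟫ = 0
    · by_cases h2 : ⟪a, γ⟫ = 0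
      · obtain ⟨x, y, hxy⟩ := Submodule.mem_span_pair.1 ha.2
        refine absurd (inner_self_eq_zero (𝕜 := ℝ).1 ?_) (hΦ.ne_zero a ha.1)
        nth_rewrite 2 [← hxy]
        rw [inner_add_right, real_inner_smul_right, real_inner_smul_right, h1, h2]
        simp
      · exact .tail (.single ⟨ha, hγΨ, h2⟩) ⟨hγΨ, hαΨ, hγα⟩
    · exact .single ⟨ha, hαΨ, h1⟩
  have : Std.Symm (chainRel Ψ) := ⟨fun _ _ => hsymm⟩
  exact ⟨⟨α, hαΨ⟩, fun a ha b hb => (key a ha).trans (symm (key b hb))⟩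

/-- If `V` is a `2`-small subspace of `span ℝ Φ` and `α, β ∈ Φ ∩ V` are linearly independent,
then there is a rank-2 irreducible saturated root subsystem `Ψ ⊆ Φ` with `α ∈ Ψ`, `β ∉ Ψ`,
and `span ℝ Ψ ∩ V = ℝα`. -/
theorem exists_rank_two_subsystem_avoiding [FiniteDimensional ℝ E]
    (Φ : Set E) (hΦ : IsRootSystem Φ)
    (V : Submodule ℝ E) (hV : V ≤ Submodule.span ℝ Φ) (hsmall : IsSmall Φ V 2)
    (α β : E) (hα : α ∈ Φ) (hβ : β ∈ Φ) (hαV : α ∈ V) (hβV : β ∈ V)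
    (hind : LinearIndependent ℝ ![α, β]) :
    ∃ Ψ : Set E, IsSaturatedSubsystem Φ Ψ ∧ IsIrreducibleSubsystem Ψ ∧ rootRank Ψ = 2 ∧
      α ∈ Ψ ∧ β ∉ Ψ ∧ Submodule.span ℝ Ψ ⊓ V = Submodule.span ℝ {α} := by
  have hα0 : α ≠ 0 := hΦ.ne_zero α hα
  obtain ⟨γ, hγ, hγα, hγV⟩ : ∃ γ ∈ Φ, ⟪γ, α⟫ ≠ 0 ∧ γ ∉ V := by
    by_contra! h
    have hle : Submodule.span ℝ (component Φ α) ≤ V :=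
      Submodule.span_le.2 (component_subset_of_nonorthogonal hΦ hα V h)
    have := hsmall α hα
    rw [inf_eq_right.2 hle] at this
    omega
  set U : Submodule ℝ E := Submodule.span ℝ {α, γ} with hU
  have hαU : α ∈ U := Submodule.subset_span (by simp)
  have hγU : γ ∈ U := Submodule.subset_span (by simp)
  have hspan : Submodule.span ℝ (Φ ∩ (U : Set E)) = U := by
    refine le_antisymm (Submodule.span_le.2 Set.inter_subset_right) (Submodule.span_mono ?_)
    rintro x (rfl | rfl)
    exacts [⟨hα, hαU⟩, ⟨hγ, hγU⟩]
  have coeff_zero : ∀ x y : ℝ, x • α + y • γ ∈ V → y = 0 := by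
    intro x y h
    by_contra hy
    exact hγV ((V.smul_mem_iff hy).1 ((V.add_mem_iff_right (V.smul_mem x hαV)).1 h))
  have hUV : U ⊓ V = Submodule.span ℝ {α} := by
    refine le_antisymm ?_ ((Submodule.span_singleton_le_iff_mem _ _).2 ⟨hαU, hαV⟩)
    rintro z ⟨hzU, hzV⟩
    obtain ⟨x, y, rfl⟩ := Submodule.mem_span_pair.1 hzU
    have hy := coeff_zero x y hzV
    exact Submodule.mem_span_singleton.2 ⟨x, by simp [hy]⟩
  refine ⟨Φ ∩ U, ⟨U, rfl⟩, isIrreducibleSubsystem_inter_span_pair hΦ hα hγ hγα, ?_,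
    ⟨hα, hαU⟩, ?_, by rw [hspan, hUV]⟩
  · have hli : LinearIndependent ℝ ![α, γ] := by
      refine LinearIndependent.pair_iff.2 fun x y h => ?_
      have hy : y = 0 := coeff_zero x y (h ▸ V.zero_mem)
      simpa [hy, hα0] using h
    have := finrank_span_eq_card hli
    rw [rootRank, hspan, hU, ← Matrix.range_cons_cons_empty α γ ![]]
    simpa using this
  · intro hβU
    have hβ' : β ∈ Submodule.span ℝ {α} := hUV ▸ ⟨hβU.2, hβV⟩
    obtain ⟨c, hc⟩ := Submodule.mem_span_singleton.1 hβ'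
    have := (LinearIndependent.pair_iff.1 hind c (-1) (by simp [hc])).2
    norm_num at this
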